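/- arXiv:2309.04984 — 2 statements merged into one kernel-verified Lean document; each statement's English description precedes it below -/
import Mathlib

section
/- Under Assumptions (A1), (A2) and (A4), the WQNP iterates satisfy, pathwise, ‖θ̃_{k+j} − θ̃_k‖ = ‖θ̂_{k+j} − θ̂_k‖ ≤ j (m+1) ᾱ* φ̄ ‖P_k‖ for all k ≥ 1 and all integers j ≥ 0, where ᾱ* = sup_{i,k} |α_{i,k}| < ∞. In particular, each one-step increment satisfies ‖θ̂_l − θ̂_{l−1}‖ ≤ 2 ᾱ* φ̄ ‖P_{l−1}‖. -/
set_option autoImplicit false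

open MeasureTheory ProbabilityTheory Filter Finset Matrix

/-- The density of the Gaussian distribution `N(0, σ²)`. -/
noncomputable def gaussPdf (σ x : ℝ) : ℝ :=
  (σ * Real.sqrt (2 * Real.pi))⁻¹ * Real.exp (-(x ^ 2) / (2 * σ ^ 2))

/-- The cumulative distribution function of the Gaussian distribution `N(0, σ²)`. -/
noncomputable def gaussCdf (σ x : ℝ) : ℝ := ∫ t in Set.Iic x, gaussPdf σ t

/-- `H i x = F(Cᵢ - x) - F(Cᵢ₋₁ - x)` for `i = 1, …, m+1`, with the conventions
`C₀ = -∞`, `C_{m+1} = +∞` (so `F(C₀ - x) = 0` and `F(C_{m+1} - x) = 1`). -/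
noncomputable def Hfun (σ : ℝ) (m : ℕ) (C : ℕ → ℝ) (i : ℕ) (x : ℝ) : ℝ :=
  if i = 1 then gaussCdf σ (C 1 - x)
  else if i = m + 1 then 1 - gaussCdf σ (C m - x)
  else gaussCdf σ (C i - x) - gaussCdf σ (C (i - 1) - x)

/-- `h i x = f(Cᵢ - x) - f(Cᵢ₋₁ - x)` for `i = 1, …, m+1`, with the conventions
`C₀ = -∞`, `C_{m+1} = +∞` (so `f(C₀ - x) = f(C_{m+1} - x) = 0`). -/
noncomputable def hfun (σ : ℝ) (m : ℕ) (C : ℕ → ℝ) (i : ℕ) (x : ℝ) : ℝ :=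
  if i = 1 then gaussPdf σ (C 1 - x)
  else if i = m + 1 then -gaussPdf σ (C m - x)
  else gaussPdf σ (C i - x) - gaussPdf σ (C (i - 1) - x)

/-- Indicator (as a real number) of the event `Cᵢ₋₁ < y ≤ Cᵢ`, for `i = 1, …, m+1`,
with the conventions `C₀ = -∞`, `C_{m+1} = +∞`. -/
noncomputable def qInd (m : ℕ) (C : ℕ → ℝ) (i : ℕ) (y : ℝ) : ℝ :=
  if i = 1 then (if y ≤ C 1 then 1 else 0)
  else if i = m + 1 then (if C m < y then 1 else 0)
  else (if C (i - 1) < y ∧ y ≤ C i then 1 else 0)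

/-- The spectral norm (ℓ²-operator norm) of a real square matrix. -/
noncomputable def specNorm {n : ℕ} (A : Matrix (Fin n) (Fin n) ℝ) : ℝ :=
  ‖LinearMap.toContinuousLinearMap (Matrix.toEuclideanLin A)‖

lemma symm_dot {n : ℕ} {P : Matrix (Fin n) (Fin n) ℝ} (hP : P.PosDef) (x y : Fin n → ℝ) :
    x ⬝ᵥ (P *ᵥ y) = y ⬝ᵥ (P *ᵥ x) := by
  have hT : Pᵀ = P := by
    have := hP.isHermitian
    rwa [Matrix.IsHermitian, Matrix.conjTranspose_eq_transpose_of_trivial] at this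
  rw [dotProduct_mulVec, ← mulVec_transpose, hT, dotProduct_comm]

lemma pd_pos {n : ℕ} {P : Matrix (Fin n) (Fin n) ℝ} (hP : P.PosDef) {x : Fin n → ℝ}
    (hx : x ≠ 0) : 0 < x ⬝ᵥ (P *ᵥ x) := by
  have := hP.dotProduct_mulVec_pos hx
  simpa using this

lemma pd_nonneg {n : ℕ} {P : Matrix (Fin n) (Fin n) ℝ} (hP : P.PosDef) (x : Fin n → ℝ) :
    0 ≤ x ⬝ᵥ (P *ᵥ x) := by
  by_cases hx : x = 0
  · simp [hx]
  · exact (pd_pos hP hx).le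

lemma quad_expand {n : ℕ} {P : Matrix (Fin n) (Fin n) ℝ} (hP : P.PosDef) (x y : Fin n → ℝ)
    (t : ℝ) : (x - t • y) ⬝ᵥ (P *ᵥ (x - t • y)) =
      x ⬝ᵥ (P *ᵥ x) - 2 * t * (x ⬝ᵥ (P *ᵥ y)) + t ^ 2 * (y ⬝ᵥ (P *ᵥ y)) := by
  have h := symm_dot hP y x
  simp only [mulVec_sub, mulVec_smul, sub_dotProduct, dotProduct_sub, smul_dotProduct,
    dotProduct_smul, smul_eq_mul, h]
  ring

lemma pd_cs {n : ℕ} {P : Matrix (Fin n) (Fin n) ℝ} (hP : P.PosDef) (x y : Fin n → ℝ) :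
    (x ⬝ᵥ (P *ᵥ y)) ^ 2 ≤ (x ⬝ᵥ (P *ᵥ x)) * (y ⬝ᵥ (P *ᵥ y)) := by
  by_cases hy : y = 0
  · simp [hy]
  have hp := pd_pos hP hy
  have h := pd_nonneg hP (x - ((x ⬝ᵥ (P *ᵥ y)) / (y ⬝ᵥ (P *ᵥ y))) • y)
  rw [quad_expand hP] at h
  set b := x ⬝ᵥ (P *ᵥ y)
  set p := y ⬝ᵥ (P *ᵥ y)
  set A := x ⬝ᵥ (P *ᵥ x)
  have e : A - 2 * (b / p) * b + (b / p) ^ 2 * p = (A * p - b ^ 2) / p := by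
    field_simp
    ring
  rw [e] at h
  have := mul_nonneg h hp.le
  rw [div_mul_cancel₀ _ hp.ne'] at this
  linarith

lemma dot_self_nonneg' {n : ℕ} (x : Fin n → ℝ) : 0 ≤ x ⬝ᵥ x :=
  Finset.sum_nonneg fun i _ => mul_self_nonneg (x i)

lemma proj_step {n : ℕ} {P : Matrix (Fin n) (Fin n) ℝ} (hP : P.PosDef) (M : ℝ) (hM : 0 ≤ M)
    (hB : ∀ x : Fin n → ℝ, x ⬝ᵥ (P *ᵥ x) ≤ M * (x ⬝ᵥ x))
    (S : Set (Fin n → ℝ)) (hS : Convex ℝ S) (u x v f : Fin n → ℝ) (s F : ℝ)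
    (hu : u ∈ S) (hx : x ∈ S) (hv : v - u = s • (P *ᵥ f)) (hF : f ⬝ᵥ f ≤ F ^ 2)
    (hmin : ∀ z ∈ S, (v - x) ⬝ᵥ (P⁻¹ *ᵥ (v - x)) ≤ (v - z) ⬝ᵥ (P⁻¹ *ᵥ (v - z))) :
    (x - u) ⬝ᵥ (x - u) ≤ (M * s * F) ^ 2 := by
  have hQ : (P⁻¹).PosDef := hP.inv
  have hdet : IsUnit P.det := hP.det_pos.ne'.isUnit
  -- variational inequality
  have hvar : (v - x) ⬝ᵥ (P⁻¹ *ᵥ (u - x)) ≤ 0 := by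
    set c := (v - x) ⬝ᵥ (P⁻¹ *ᵥ (u - x)) with hc
    set d := (u - x) ⬝ᵥ (P⁻¹ *ᵥ (u - x)) with hd
    have hd0 : 0 ≤ d := pd_nonneg hQ _
    have key : ∀ t : ℝ, 0 ≤ t → t ≤ 1 → 0 ≤ - 2 * t * c + t ^ 2 * d := by
      intro t h0 h1
      have hz : x + t • (u - x) ∈ S := hS.add_smul_sub_mem hx hu ⟨h0, h1⟩
      have h := hmin _ hz
      have e : v - (x + t • (u - x)) = (v - x) - t • (u - x) := by abel
      rw [e, quad_expand hQ] at h
      linarith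
    by_contra hpos
    push Not at hpos
    have ht : 0 < c / (c + d) := by positivity
    have h := key (c / (c + d)) ht.le (by rw [div_le_one (by positivity)]; linarith)
    have e : - 2 * (c / (c + d)) * c + (c / (c + d)) ^ 2 * d
        = (c / (c + d)) * (-2 * c + c / (c + d) * d) := by ring
    rw [e] at h
    have h2 := nonneg_of_mul_nonneg_right h ht
    have h3 : c / (c + d) * d ≤ c := by
      rw [div_mul_eq_mul_div, div_le_iff₀ (by positivity)]
      nlinarith
    linarith
  have hnon : (x - u) ⬝ᵥ (P⁻¹ *ᵥ (x - u)) ≤ (v - u) ⬝ᵥ (P⁻¹ *ᵥ (v - u)) := by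
    have e : v - u = (v - x) - (1 : ℝ) • (u - x) := by rw [one_smul]; abel
    have e2 : x - u = -(u - x) := by abel
    rw [e, quad_expand hQ, e2, mulVec_neg, neg_dotProduct, dotProduct_neg, neg_neg]
    have := pd_nonneg hQ (v - x)
    linarith
  have hval : (v - u) ⬝ᵥ (P⁻¹ *ᵥ (v - u)) = s ^ 2 * (f ⬝ᵥ (P *ᵥ f)) := by
    rw [hv, mulVec_smul, mulVec_mulVec, Matrix.nonsing_inv_mul _ hdet, one_mulVec,
      smul_dotProduct, dotProduct_smul, dotProduct_comm]
    simp only [smul_eq_mul]; ring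
  have hnorm : (x - u) ⬝ᵥ (x - u) ≤ M * ((x - u) ⬝ᵥ (P⁻¹ *ᵥ (x - u))) := by
    set w := P⁻¹ *ᵥ (x - u) with hw
    have hPw : P *ᵥ w = x - u := by
      rw [hw, mulVec_mulVec, Matrix.mul_nonsing_inv _ hdet, one_mulVec]
    have hcs := pd_cs hP (x - u) w
    rw [hPw, dotProduct_comm w] at hcs
    set X := (x - u) ⬝ᵥ (x - u) with hX
    have hX0 : 0 ≤ X := dot_self_nonneg' _
    have hb := hB (x - u)
    have hw0 : 0 ≤ (x - u) ⬝ᵥ w := pd_nonneg hQ _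
    rcases hX0.eq_or_lt with h | h
    · rw [← h]; positivity
    · have h1 : X ^ 2 ≤ M * X * ((x - u) ⬝ᵥ w) :=
        hcs.trans (mul_le_mul_of_nonneg_right hb hw0)
      have h2 : X * X ≤ X * (M * ((x - u) ⬝ᵥ w)) := by linarith [h1]
      exact le_of_mul_le_mul_left h2 h
  calc (x - u) ⬝ᵥ (x - u) ≤ M * ((x - u) ⬝ᵥ (P⁻¹ *ᵥ (x - u))) := hnorm
    _ ≤ M * (s ^ 2 * (f ⬝ᵥ (P *ᵥ f))) := by rw [← hval]; gcongr
    _ ≤ M * (s ^ 2 * (M * F ^ 2)) := by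
        gcongr
        exact (hB f).trans (by gcongr)
    _ = (M * s * F) ^ 2 := by ring

lemma upd_quad {n : ℕ} {P : Matrix (Fin n) (Fin n) ℝ} (hP : P.PosDef) (f x : Fin n → ℝ) (c : ℝ) :
    x ⬝ᵥ ((P - c • (P * vecMulVec f f * P)) *ᵥ x)
      = x ⬝ᵥ (P *ᵥ x) - c * (x ⬝ᵥ (P *ᵥ f)) ^ 2 := by
  have h := symm_dot hP f x
  rw [sub_mulVec, smul_mulVec, ← mulVec_mulVec, ← mulVec_mulVec, vecMulVec_mulVec,
    dotProduct_sub, dotProduct_smul]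
  simp only [op_smul_eq_smul, mulVec_smul, dotProduct_smul, smul_eq_mul, h]
  ring

lemma upd_pd {n : ℕ} {P : Matrix (Fin n) (Fin n) ℝ} (hP : P.PosDef) (f : Fin n → ℝ) (a b : ℝ)
    (hb : 0 < b) (ha : a = (1 + b * (f ⬝ᵥ (P *ᵥ f)))⁻¹) :
    (P - (a * b) • (P * vecMulVec f f * P)).PosDef ∧ 0 < a ∧
    (P - (a * b) • (P * vecMulVec f f * P)) *ᵥ f = a • (P *ᵥ f) := by
  have hp := pd_nonneg hP f
  have h1 : 0 < 1 + b * (f ⬝ᵥ (P *ᵥ f)) := by positivity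
  have ha0 : 0 < a := by rw [ha]; positivity
  have hab : a * b * (f ⬝ᵥ (P *ᵥ f)) = 1 - a := by
    have : a * (1 + b * (f ⬝ᵥ (P *ᵥ f))) = 1 := by rw [ha]; exact inv_mul_cancel₀ h1.ne'
    linarith
  have hT : Pᵀ = P := by
    have := hP.isHermitian
    rwa [Matrix.IsHermitian, Matrix.conjTranspose_eq_transpose_of_trivial] at this
  refine ⟨?_, ha0, ?_⟩
  · refine Matrix.PosDef.of_dotProduct_mulVec_pos ?_ ?_
    · rw [Matrix.IsHermitian, Matrix.conjTranspose_eq_transpose_of_trivial]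
      simp [transpose_sub, transpose_smul, transpose_mul, hT, transpose_vecMulVec, Matrix.mul_assoc]
    · intro x hx
      rw [star_trivial, upd_quad hP]
      have hA := pd_pos hP hx
      have h := pd_nonneg hP (x - (a * b * (x ⬝ᵥ (P *ᵥ f))) • f)
      rw [quad_expand hP] at h
      set B := x ⬝ᵥ (P *ᵥ f)
      set A := x ⬝ᵥ (P *ᵥ x)
      set p := f ⬝ᵥ (P *ᵥ f)
      have e : A - 2 * (a * b * B) * B + (a * b * B) ^ 2 * p
          = A - a * b * B ^ 2 - a * (a * b * B ^ 2) := by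
        have : (a * b * B) ^ 2 * p = (a * b * p) * (a * b * B ^ 2) := by ring
        rw [this, hab]; ring
      rw [e] at h
      by_cases hB : B = 0
      · rw [hB]; simpa using hA
      · have : 0 < a * (a * b * B ^ 2) := by positivity
        linarith
  · rw [sub_mulVec, smul_mulVec, ← mulVec_mulVec, ← mulVec_mulVec, vecMulVec_mulVec]
    simp only [op_smul_eq_smul, mulVec_smul, smul_smul, hab]
    rw [sub_smul, one_smul]; abel

lemma sqrt_dot {n : ℕ} (x : Fin n → ℝ) : Real.sqrt (x ⬝ᵥ x) = ‖WithLp.toLp 2 x‖ := by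
  rw [EuclideanSpace.norm_eq]
  congr 1
  simp [dotProduct, sq]

lemma spec_bd {n : ℕ} (P : Matrix (Fin n) (Fin n) ℝ) (x : Fin n → ℝ) :
    x ⬝ᵥ (P *ᵥ x) ≤ specNorm P * (x ⬝ᵥ x) := by
  have h1 := (LinearMap.toContinuousLinearMap (Matrix.toEuclideanLin P)).le_opNorm
    (WithLp.toLp 2 x)
  have h2 := real_inner_le_norm (WithLp.toLp 2 (P *ᵥ x)) (WithLp.toLp 2 x)
  have h3 : inner ℝ (WithLp.toLp 2 (P *ᵥ x)) (WithLp.toLp 2 x) = x ⬝ᵥ (P *ᵥ x) := by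
    simp [EuclideanSpace.inner_eq_star_dotProduct]
  have h4 : LinearMap.toContinuousLinearMap (Matrix.toEuclideanLin P) (WithLp.toLp 2 x)
      = WithLp.toLp 2 (P *ᵥ x) := by simp
  rw [h4] at h1
  have h5 : x ⬝ᵥ x = ‖WithLp.toLp 2 x‖ * ‖WithLp.toLp 2 x‖ := by
    rw [← sqrt_dot, Real.mul_self_sqrt (dot_self_nonneg' x)]
  rw [h3] at h2
  rw [h5, ← mul_assoc]
  exact h2.trans (mul_le_mul_of_nonneg_right h1 (norm_nonneg _))

lemma gaussPdf_eq {σ : ℝ} (hσ : 0 < σ) :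
    gaussPdf σ = gaussianPDFReal 0 (Real.toNNReal (σ ^ 2)) := by
  funext x
  unfold gaussPdf gaussianPDFReal
  have : Real.sqrt (2 * Real.pi * σ ^ 2) = σ * Real.sqrt (2 * Real.pi) := by
    rw [Real.sqrt_mul (by positivity), Real.sqrt_sq hσ.le, mul_comm]
  rw [Real.coe_toNNReal _ (sq_nonneg σ), this, sub_zero]

lemma gaussCdf_props {σ : ℝ} (hσ : 0 < σ) :
    Monotone (gaussCdf σ) ∧ (∀ x, 0 ≤ gaussCdf σ x) ∧ ∀ x, gaussCdf σ x ≤ 1 := by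
  have hv : Real.toNNReal (σ ^ 2) ≠ 0 := (Real.toNNReal_pos.2 (by positivity)).ne'
  have hint : Integrable (gaussPdf σ) := by
    rw [gaussPdf_eq hσ]; exact integrable_gaussianPDFReal _ _
  have hnn : ∀ x, 0 ≤ gaussPdf σ x := fun x => by
    rw [gaussPdf_eq hσ]; exact gaussianPDFReal_nonneg _ _ _
  refine ⟨fun x y h => ?_, fun x => ?_, fun x => ?_⟩
  · exact setIntegral_mono_set hint.integrableOn (Eventually.of_forall hnn)
      (Set.Iic_subset_Iic.2 h).eventuallyLE
  · exact integral_nonneg hnn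
  · have h1 : gaussCdf σ x ≤ ∫ t, gaussPdf σ t :=
      setIntegral_le_integral hint (Eventually.of_forall hnn)
    rw [gaussPdf_eq hσ, integral_gaussianPDFReal_eq_one _ hv] at h1
    exact h1

lemma tele_aux (G : ℕ → ℝ) (m : ℕ) (hm : 1 ≤ m) :
    ∑ i ∈ Icc 1 m, (if i = 1 then G 1 else G i - G (i - 1)) = G m := by
  induction m, hm using Nat.le_induction with
  | base => simp
  | succ k hk ih =>
    rw [Finset.sum_Icc_succ_top (by omega), ih, if_neg (by omega)]
    simp

lemma weighted_bd (G w : ℕ → ℝ) (m : ℕ) (hm : 1 ≤ m) (A : ℝ)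
    (hw : ∀ i, 1 ≤ i → i ≤ m + 1 → |w i| ≤ A)
    (h0 : 0 ≤ G 1) (h1 : G m ≤ 1) (hmono : ∀ i, 2 ≤ i → i ≤ m → G (i - 1) ≤ G i) (K : ℕ → ℝ)
    (hK : ∀ i, 1 ≤ i → i ≤ m + 1 → K i =
      if i = 1 then G 1 else if i = m + 1 then 1 - G m else G i - G (i - 1)) :
    |∑ i ∈ Icc 1 (m + 1), w i * K i| ≤ A := by
  have hsum : ∑ i ∈ Icc 1 (m + 1), K i = 1 := by
    rw [Finset.sum_Icc_succ_top (by omega), hK (m + 1) (by omega) le_rfl, if_neg (by omega),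
      if_pos rfl]
    have : ∑ i ∈ Icc 1 m, K i = ∑ i ∈ Icc 1 m, (if i = 1 then G 1 else G i - G (i - 1)) := by
      refine Finset.sum_congr rfl fun i hi => ?_
      rw [Finset.mem_Icc] at hi
      rw [hK i hi.1 (by omega), if_neg (show ¬ i = m + 1 by omega)]
    rw [this, tele_aux G m hm]; ring
  have hK0 : ∀ i ∈ Icc 1 (m + 1), 0 ≤ K i := by
    intro i hi
    rw [Finset.mem_Icc] at hi
    rw [hK i hi.1 hi.2]
    split_ifs with h h'
    · exact h0
    · linarith
    · have := hmono i (by omega) (by omega)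
      linarith
  calc |∑ i ∈ Icc 1 (m + 1), w i * K i| ≤ ∑ i ∈ Icc 1 (m + 1), |w i * K i| :=
        Finset.abs_sum_le_sum_abs _ _
    _ ≤ ∑ i ∈ Icc 1 (m + 1), A * K i := by
        refine Finset.sum_le_sum fun i hi => ?_
        rw [abs_mul, abs_of_nonneg (hK0 i hi)]
        have := Finset.mem_Icc.1 hi
        exact mul_le_mul_of_nonneg_right (hw i this.1 this.2) (hK0 i hi)
    _ = A := by rw [← Finset.mul_sum, hsum, mul_one]

lemma stil_bd {m : ℕ} (hm : 1 ≤ m) {σ : ℝ} (hσ : 0 < σ)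
    (C : ℕ → ℝ) (hC : ∀ i j, 1 ≤ i → i < j → j ≤ m → C i < C j) (w : ℕ → ℝ) (A : ℝ)
    (hw : ∀ i, 1 ≤ i → i ≤ m + 1 → |w i| ≤ A) (y x : ℝ) :
    |(∑ i ∈ Icc 1 (m + 1), w i * qInd m C i y)
        - ∑ i ∈ Icc 1 (m + 1), w i * Hfun σ m C i x| ≤ 2 * A := by
  obtain ⟨g1, g2, g3⟩ := gaussCdf_props hσ
  have a1 : |∑ i ∈ Icc 1 (m + 1), w i * qInd m C i y| ≤ A := by
    refine weighted_bd (fun i => if y ≤ C i then 1 else 0) w m hm A hw ?_ ?_ ?_ _ ?_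
    · split_ifs <;> norm_num
    · split_ifs <;> norm_num
    · intro i h2 hi
      have := hC (i - 1) i (by omega) (by omega) hi
      split_ifs <;> first | linarith | norm_num
    · intro i h1 hi
      unfold qInd
      split_ifs with h h' h'' <;> first | norm_num; done | skip
      all_goals first | (exfalso; linarith) | skip
      all_goals
        have := hC (i - 1) i (by omega) (by omega) (by omega)
        grind
  have a2 : |∑ i ∈ Icc 1 (m + 1), w i * Hfun σ m C i x| ≤ A := by
    refine weighted_bd (fun i => gaussCdf σ (C i - x)) w m hm A hw (g2 _) (g3 _) ?_ _ ?_
    · intro i h2 hi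
      have := hC (i - 1) i (by omega) (by omega) hi
      exact g1 (by linarith)
    · intro i h1 hi
      rfl
  rw [abs_le] at *
  constructor <;> linarith [a1.1, a1.2, a2.1, a2.2]

/-- pathwise increment bound for the WQNP iterates:
`‖θ̂_{k+j} - θ̂_k‖ ≤ j (m+1) ᾱ* φ̄ ‖P_k‖` and in particular
`‖θ̂_l - θ̂_{l-1}‖ ≤ 2 ᾱ* φ̄ ‖P_{l-1}‖`, with `ᾱ* = sup_{i,k} |α_{i,k}|`
and `‖·‖` the spectral norm. -/
theorem stmt_12 {n m : ℕ} (hn : 1 ≤ n) (hm : 1 ≤ m) {σ : ℝ} (hσ : 0 < σ)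
    (C : ℕ → ℝ) (hC : ∀ i j, 1 ≤ i → i < j → j ≤ m → C i < C j)
    (θ : Fin n → ℝ) (Ωs : Set (Fin n → ℝ))
    (hΩb : Bornology.IsBounded Ωs) (hΩc : Convex ℝ Ωs)
    (φ : ℕ → Fin n → ℝ) (φbar : ℝ) (hφ : ∀ k, Real.sqrt (φ k ⬝ᵥ φ k) ≤ φbar)
    -- (A4)-type weight conditions
    (α : ℕ → ℕ → ℝ) (β : ℕ → ℝ) (αlow αbar βlow βbar : ℝ)
    (hαmono : ∀ i k : ℕ, 1 ≤ i → i ≤ m → α i k < α (i + 1) k)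
    (hαlow : ∀ k, αlow ≤ α 1 k) (hαbar : ∀ k, α (m + 1) k ≤ αbar)
    (hβlow : 0 < βlow) (hβ : ∀ k, βlow ≤ β k ∧ β k ≤ βbar)
    (αstar : ℝ) (hαstar : ∀ i k : ℕ, 1 ≤ i → i ≤ m + 1 → |α i k| ≤ αstar)
    -- arbitrary observations
    (y : ℕ → ℝ)
    -- the WQNP algorithm
    (P0 : Matrix (Fin n) (Fin n) ℝ) (hP0 : P0.PosDef)
    (hatθ : ℕ → Fin n → ℝ) (Pm : ℕ → Matrix (Fin n) (Fin n) ℝ)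
    (a stil : ℕ → ℝ) (v : ℕ → Fin n → ℝ)
    (hPm0 : Pm 0 = P0) (hθ0 : hatθ 0 ∈ Ωs)
    (ha : ∀ k : ℕ, 1 ≤ k → a k = (1 + β k * (φ k ⬝ᵥ (Pm (k - 1) *ᵥ φ k)))⁻¹)
    (hstil : ∀ k : ℕ, 1 ≤ k → stil k =
      (∑ i ∈ Icc 1 (m + 1), α i k * qInd m C i (y k))
        - ∑ i ∈ Icc 1 (m + 1), α i k * Hfun σ m C i (φ k ⬝ᵥ hatθ (k - 1)))
    (hPrec : ∀ k : ℕ, 1 ≤ k →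
      Pm k = Pm (k - 1)
        - (a k * β k) • (Pm (k - 1) * vecMulVec (φ k) (φ k) * Pm (k - 1)))
    (hv : ∀ k : ℕ, 1 ≤ k → v k = hatθ (k - 1) + (a k * stil k) • (Pm (k - 1) *ᵥ φ k))
    (hproj : ∀ k : ℕ, 1 ≤ k → hatθ k ∈ closure Ωs ∧
      ∀ z ∈ closure Ωs,
        (v k - hatθ k) ⬝ᵥ ((Pm k)⁻¹ *ᵥ (v k - hatθ k))
          ≤ (v k - z) ⬝ᵥ ((Pm k)⁻¹ *ᵥ (v k - z))) :
    (∀ k : ℕ, 1 ≤ k → ∀ j : ℕ,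
      Real.sqrt ((hatθ (k + j) - hatθ k) ⬝ᵥ (hatθ (k + j) - hatθ k))
        ≤ (j : ℝ) * (m + 1) * αstar * φbar * specNorm (Pm k)) ∧
    (∀ l : ℕ, 1 ≤ l →
      Real.sqrt ((hatθ l - hatθ (l - 1)) ⬝ᵥ (hatθ l - hatθ (l - 1)))
        ≤ 2 * αstar * φbar * specNorm (Pm (l - 1))) := by
  have hPD : ∀ k, (Pm k).PosDef := by
    intro k
    induction k with
    | zero => rw [hPm0]; exact hP0
    | succ k ih =>
      rw [hPrec (k + 1) (by omega)]
      exact (upd_pd (P := Pm (k + 1 - 1)) ih (φ (k + 1)) _ _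
        (hβlow.trans_le (hβ (k + 1)).1) (ha (k + 1) (by omega))).1
  have hmem : ∀ k, hatθ k ∈ closure Ωs := by
    intro k
    rcases Nat.eq_zero_or_pos k with h | h
    · rw [h]; exact subset_closure hθ0
    · exact (hproj k h).1
  have hφ0 : 0 ≤ φbar := (Real.sqrt_nonneg _).trans (hφ 0)
  have hα0 : 0 ≤ αstar := (abs_nonneg _).trans (hαstar 1 0 le_rfl (by omega))
  have hmonoP : ∀ (k : ℕ) (x : Fin n → ℝ),
      x ⬝ᵥ (Pm (k + 1) *ᵥ x) ≤ x ⬝ᵥ (Pm k *ᵥ x) := by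
    intro k x
    have hb := hβlow.trans_le (hβ (k + 1)).1
    have h := upd_pd (P := Pm k) (hPD k) (φ (k + 1)) _ _ hb (ha (k + 1) (by omega))
    rw [hPrec (k + 1) (by omega), Nat.add_sub_cancel, upd_quad (hPD k)]
    have := mul_nonneg (mul_pos h.2.1 hb).le (sq_nonneg (x ⬝ᵥ (Pm k *ᵥ φ (k + 1))))
    linarith
  have hstep : ∀ (k : ℕ) (M : ℝ), 0 ≤ M →
      (∀ x : Fin n → ℝ, x ⬝ᵥ (Pm k *ᵥ x) ≤ M * (x ⬝ᵥ x)) →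
      Real.sqrt ((hatθ (k + 1) - hatθ k) ⬝ᵥ (hatθ (k + 1) - hatθ k))
        ≤ 2 * αstar * φbar * M := by
    intro k M hM hB
    have hb := hβlow.trans_le (hβ (k + 1)).1
    have h := upd_pd (P := Pm k) (hPD k) (φ (k + 1)) _ _ hb (ha (k + 1) (by omega))
    have hr := hPrec (k + 1) (by omega)
    rw [Nat.add_sub_cancel] at hr
    rw [← hr] at h
    have hvv := hv (k + 1) (by omega)
    rw [Nat.add_sub_cancel] at hvv
    have hs : |stil (k + 1)| ≤ 2 * αstar := by
      rw [hstil (k + 1) (by omega)]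
      exact stil_bd hm hσ C hC (fun i => α i (k + 1)) αstar
        (fun i h1 h2 => hαstar i (k + 1) h1 h2) _ _
    have hf : φ (k + 1) ⬝ᵥ φ (k + 1) ≤ φbar ^ 2 := by
      have := hφ (k + 1)
      rwa [Real.sqrt_le_left hφ0] at this
    have key := proj_step (hPD (k + 1)) M hM (fun x => (hmonoP k x).trans (hB x)) (closure Ωs)
      hΩc.closure (hatθ k) (hatθ (k + 1)) (v (k + 1)) (φ (k + 1)) (stil (k + 1)) φbar
      (hmem k) (hmem _) (by rw [h.2.2, hvv, smul_smul, mul_comm (stil (k + 1))]; simp)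
      hf (hproj (k + 1) (by omega)).2
    calc _ ≤ Real.sqrt ((M * stil (k + 1) * φbar) ^ 2) := Real.sqrt_le_sqrt key
      _ = M * |stil (k + 1)| * φbar := by
        rw [Real.sqrt_sq_eq_abs, abs_mul, abs_mul, abs_of_nonneg hM, abs_of_nonneg hφ0]
      _ ≤ M * (2 * αstar) * φbar := by gcongr
      _ = _ := by ring
  have hspec0 : ∀ k, 0 ≤ specNorm (Pm k) := fun k => norm_nonneg _
  refine ⟨fun k _ j => ?_, fun l hl => ?_⟩
  · have hB : ∀ (j : ℕ) (x : Fin n → ℝ),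
        x ⬝ᵥ (Pm (k + j) *ᵥ x) ≤ specNorm (Pm k) * (x ⬝ᵥ x) := by
      intro j x
      induction j with
      | zero => exact spec_bd _ _
      | succ j ih => exact (hmonoP (k + j) x).trans ih
    induction j with
    | zero => simp
    | succ j ih =>
      have hs := hstep (k + j) _ (hspec0 k) (hB j)
      rw [sqrt_dot] at hs ih ⊢
      have e : WithLp.toLp 2 (hatθ (k + (j + 1)) - hatθ k) =
          WithLp.toLp 2 (hatθ (k + j + 1) - hatθ (k + j)) +
            WithLp.toLp 2 (hatθ (k + j) - hatθ k) := by
        rw [← WithLp.toLp_add, ← add_assoc]; congr 1; abel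
      rw [e]
      refine (norm_add_le _ _).trans ((add_le_add hs ih).trans ?_)
      have hm' : (1 : ℝ) ≤ m := by exact_mod_cast hm
      have hX : 0 ≤ αstar * φbar * specNorm (Pm k) :=
        mul_nonneg (mul_nonneg hα0 hφ0) (hspec0 k)
      push_cast
      have := mul_nonneg (sub_nonneg.2 hm') hX
      linarith
  · obtain ⟨k, rfl⟩ : ∃ k, l = k + 1 := ⟨l - 1, by omega⟩
    rw [Nat.add_sub_cancel]
    exact hstep k _ (hspec0 k) (spec_bd _)
end

section
/- Let g(x, y) = (f(x) − f(y))/(F(x) − F(y)) for x ≠ y, where f and F are the density and cumulative distribution function of N(0, σ²). Then for all x ≠ y, the partial derivative of g with respect to x is strictly negative: ∂g/∂x (x, y) < 0. -/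
set_option autoImplicit false

open MeasureTheory ProbabilityTheory Filter Finset Matrix

lemma gp_cont (σ : ℝ) : Continuous (gaussPdf σ) := by
  unfold gaussPdf
  fun_prop

lemma gp_pos {σ : ℝ} (hσ : 0 < σ) (x : ℝ) : 0 < gaussPdf σ x := by
  unfold gaussPdf
  have := Real.pi_pos
  positivity

lemma gp_int {σ : ℝ} (hσ : 0 < σ) : Integrable (gaussPdf σ) := by
  have h := (integrable_exp_neg_mul_sq (b := 1 / (2 * σ ^ 2)) (by positivity)).const_mul
    (σ * Real.sqrt (2 * Real.pi))⁻¹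
  refine h.congr (Eventually.of_forall fun x => ?_)
  simp only [gaussPdf]
  congr 2
  ring

lemma gp_deriv {σ : ℝ} (hσ : 0 < σ) (x : ℝ) :
    HasDerivAt (gaussPdf σ) (-(x / σ ^ 2) * gaussPdf σ x) x := by
  have h1 : HasDerivAt (fun x : ℝ => -(x ^ 2) / (2 * σ ^ 2)) (-(2 * x) / (2 * σ ^ 2)) x := by
    have := ((hasDerivAt_pow 2 x).neg).div_const (2 * σ ^ 2)
    simpa using this
  have h2 := h1.exp.const_mul (σ * Real.sqrt (2 * Real.pi))⁻¹
  refine h2.congr_deriv ?_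
  unfold gaussPdf
  have : -(2 * x) / (2 * σ ^ 2) = -(x / σ ^ 2) := by field_simp
  rw [this]
  ring

lemma gc_deriv {σ : ℝ} (hσ : 0 < σ) (x : ℝ) :
    HasDerivAt (gaussCdf σ) (gaussPdf σ x) x := by
  have h : gaussCdf σ = fun x => gaussCdf σ 0 + ∫ t in (0:ℝ)..x, gaussPdf σ t := by
    funext x
    have := intervalIntegral.integral_Iic_sub_Iic (μ := volume) (a := 0) (b := x)
      (gp_int hσ).integrableOn (gp_int hσ).integrableOn
    rw [← this]
    unfold gaussCdf
    ring
  rw [h]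
  exact ((gp_cont σ).integral_hasStrictDerivAt 0 x).hasDerivAt.const_add _

lemma gc_mono {σ : ℝ} (hσ : 0 < σ) : StrictMono (gaussCdf σ) :=
  strictMono_of_hasDerivAt_pos (fun x => gc_deriv hσ x) (fun x => gp_pos hσ x)

lemma gh_pos {σ : ℝ} (hσ : 0 < σ) (x y : ℝ) (hxy : x ≠ y) :
    0 < x / σ ^ 2 * (gaussCdf σ x - gaussCdf σ y) + (gaussPdf σ x - gaussPdf σ y) := by
  have hd : ∀ x, HasDerivAt (fun x => x / σ ^ 2 * (gaussCdf σ x - gaussCdf σ y)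
      + (gaussPdf σ x - gaussPdf σ y)) ((gaussCdf σ x - gaussCdf σ y) / σ ^ 2) x := by
    intro x
    have := (((hasDerivAt_id x).div_const (σ ^ 2)).mul ((gc_deriv hσ x).sub_const
      (gaussCdf σ y))).add ((gp_deriv hσ x).sub_const (gaussPdf σ y))
    refine this.congr_deriv ?_
    simp only [id]
    ring
  have hc : Continuous (fun x => x / σ ^ 2 * (gaussCdf σ x - gaussCdf σ y)
      + (gaussPdf σ x - gaussPdf σ y)) :=
    continuous_iff_continuousAt.2 fun x => (hd x).continuousAt
  have hs : 0 < σ ^ 2 := by positivity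
  rcases lt_or_gt_of_ne hxy with h | h
  · have := strictAntiOn_of_deriv_neg (convex_Iic y) hc.continuousOn (by
      intro z hz
      rw [interior_Iic] at hz
      rw [(hd z).deriv]
      exact div_neg_of_neg_of_pos (sub_neg.2 (gc_mono hσ hz)) hs)
    simpa using this (Set.mem_Iic.2 h.le) (Set.mem_Iic.2 le_rfl) h
  · have := strictMonoOn_of_deriv_pos (convex_Ici y) hc.continuousOn (by
      intro z hz
      rw [interior_Ici] at hz
      rw [(hd z).deriv]
      exact div_pos (sub_pos.2 (gc_mono hσ hz)) hs)
    simpa using this (Set.mem_Ici.2 le_rfl) (Set.mem_Ici.2 h.le) h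

/-- for `g(x,y) = (f(x) - f(y))/(F(x) - F(y))` with `f, F` the Gaussian
density and CDF of `N(0,σ²)`, the partial derivative in `x` is strictly negative
whenever `x ≠ y`. -/
theorem stmt_13 {σ : ℝ} (hσ : 0 < σ) :
    ∀ x y : ℝ, x ≠ y →
      deriv (fun t => (gaussPdf σ t - gaussPdf σ y) / (gaussCdf σ t - gaussCdf σ y)) x
        < 0 := by
  intro x y hxy
  have hne : gaussCdf σ x - gaussCdf σ y ≠ 0 :=
    sub_ne_zero.2 fun h => hxy ((gc_mono hσ).injective h)
  have hd := ((gp_deriv hσ x).sub_const (gaussPdf σ y)).fun_div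
    ((gc_deriv hσ x).sub_const (gaussCdf σ y)) hne
  rw [hd.deriv]
  refine div_neg_of_neg_of_pos ?_ (by positivity)
  have := mul_pos (gp_pos hσ x) (gh_pos hσ x y hxy)
  linarith
end
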